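/- arXiv:2511.04558 — 2 statements merged into one kernel-verified Lean document; each statement's English description precedes it below -/
import Mathlib

section
/- Let M be a (2ℓ)-level multiplexer tree and let H = (h_u) be a family of functions h_u : {0,1}^n → {0,1}, one for each leaf u ∈ [N]^{2ℓ}, such that every h_u is a constant function (constant 0 or constant 1). Then the (2ℓ)-level Talagrand function f_{M,H} : {0,1}^n → {0,1} is monotone. -/
open scoped Classical
open Finset

inductive MuxResult (N : ℕ) : Type where
  | leaf : List (Fin N) → MuxResult N
  | zeroStar : MuxResult N
  | oneStar : MuxResult N

/-- The edge into node `v` (at level `v.length`) is activated by `x`: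
the term on it (odd level) is satisfied, resp. the clause on it (even level) is
falsified. -/
def Activated {n s N : ℕ} (M : List (Fin N) → Fin s → Fin n)
    (x : Fin n → Bool) (v : List (Fin N)) : Prop :=
  if v.length % 2 = 1 then ∀ k, x (M v k) = true else ∀ k, x (M v k) = false

noncomputable def GammaAux {n s N : ℕ} (M : List (Fin N) → Fin s → Fin n)
    (x : Fin n → Bool) : ℕ → List (Fin N) → MuxResult N
  | 0, u => MuxResult.leaf u
  | fuel + 1, u =>
    if h : ∃! a : Fin N, Activated M x (a :: u) then
      GammaAux M x fuel (h.exists.choose :: u)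
    else if ∀ a : Fin N, ¬ Activated M x (a :: u) then
      (if u.length % 2 = 0 then MuxResult.zeroStar else MuxResult.oneStar)
    else
      (if u.length % 2 = 0 then MuxResult.oneStar else MuxResult.zeroStar)

/-- The multiplexer map `Γ_M` of a `(2ℓ)`-level multiplexer tree. -/
noncomputable def Gamma {n s N : ℕ} (ℓ : ℕ) (M : List (Fin N) → Fin s → Fin n)
    (x : Fin n → Bool) : MuxResult N :=
  GammaAux M x (2 * ℓ) []

/-- Hamming weight. -/
def hwt {n : ℕ} (x : Fin n → Bool) : ℕ := (univ.filter fun i => x i = true).card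

/-- The `(2ℓ)`-level Talagrand function `f_{M,H}`: `1` above the middle layers
(`|x| > n/2 + √n`, i.e. `2|x| > n + 2s`), `0` below them (`|x| < n/2 - √n`), and
determined by `Γ_M` and the leaf functions `H` within the middle layers. -/
noncomputable def TalagrandFn {n s N : ℕ} (ℓ : ℕ) (M : List (Fin N) → Fin s → Fin n)
    (H : List (Fin N) → (Fin n → Bool) → Bool) (x : Fin n → Bool) : Bool :=
  if n + 2 * s < 2 * hwt x then true
  else if 2 * hwt x + 2 * s < n then false
  else
    match Gamma ℓ M x with
    | MuxResult.zeroStar => false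
    | MuxResult.oneStar => true
    | MuxResult.leaf u => H u x

/-- The bit selected by an outcome of the multiplexer map, given the leaf functions. -/
def MuxResult.eval {n N : ℕ} (H : List (Fin N) → (Fin n → Bool) → Bool) (x : Fin n → Bool) :
    MuxResult N → Bool
  | MuxResult.zeroStar => false
  | MuxResult.oneStar => true
  | MuxResult.leaf u => H u x

lemma hwt_mono {n : ℕ} : Monotone (hwt (n := n)) := by
  intro x y hxy
  refine card_le_card fun i hi => ?_
  simp only [mem_filter, mem_univ, true_and] at hi ⊢
  exact hxy i hi

lemma Activated.mono_of_odd {n s N : ℕ} {M : List (Fin N) → Fin s → Fin n} {x y : Fin n → Bool}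
    (hxy : x ≤ y) {v : List (Fin N)} (hv : v.length % 2 = 1) (h : Activated M x v) :
    Activated M y v := by
  simp only [Activated, hv, if_true] at h ⊢
  exact fun k => hxy _ (h k)

lemma Activated.anti_of_even {n s N : ℕ} {M : List (Fin N) → Fin s → Fin n} {x y : Fin n → Bool}
    (hxy : x ≤ y) {v : List (Fin N)} (hv : v.length % 2 = 0) (h : Activated M y v) :
    Activated M x v := by
  simp only [Activated, hv, zero_ne_one, if_false] at h ⊢
  exact fun k => Bool.eq_false_of_le_false ((hxy _).trans_eq (h k))

lemma GammaAux_succ_of_unique {n s N : ℕ} (M : List (Fin N) → Fin s → Fin n) (x : Fin n → Bool)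
    (fuel : ℕ) {u : List (Fin N)} {a : Fin N} (ha : Activated M x (a :: u))
    (huniq : ∃! b : Fin N, Activated M x (b :: u)) :
    GammaAux M x (fuel + 1) u = GammaAux M x fuel (a :: u) := by
  rw [GammaAux, dif_pos huniq, huniq.unique huniq.exists.choose_spec ha]

lemma eval_GammaAux_le {n s N : ℕ} (M : List (Fin N) → Fin s → Fin n)
    (H : List (Fin N) → (Fin n → Bool) → Bool) {L : ℕ} {x y : Fin n → Bool} (hxy : x ≤ y)
    (hH : ∀ u : List (Fin N), u.length = L → H u x ≤ H u y) (fuel : ℕ) (u : List (Fin N))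
    (hu : u.length + fuel = L) :
    (GammaAux M x fuel u).eval H x ≤ (GammaAux M y fuel u).eval H y := by
  induction fuel generalizing u with
  | zero => exact hH u hu
  | succ fuel ih =>
    by_cases hx : ∃! a : Fin N, Activated M x (a :: u)
    · obtain ⟨a, hxa, hxuniq⟩ := id hx
      by_cases hy : ∃! a : Fin N, Activated M y (a :: u)
      · obtain ⟨b, hyb, hyuniq⟩ := id hy
        have hab : a = b := by
          rcases Nat.mod_two_eq_zero_or_one u.length with hp | hp
          · exact hyuniq a (hxa.mono_of_odd hxy (by simp only [List.length_cons]; omega))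
          · exact (hxuniq b (hyb.anti_of_even hxy (by simp only [List.length_cons]; omega))).symm
        subst hab
        rw [GammaAux_succ_of_unique M x fuel hxa hx, GammaAux_succ_of_unique M y fuel hyb hy]
        exact ih _ (by simp only [List.length_cons]; omega)
      · rcases Nat.mod_two_eq_zero_or_one u.length with hp | hp
        · have hya := hxa.mono_of_odd hxy (by simp only [List.length_cons]; omega)
          have hne : ¬ ∀ b : Fin N, ¬ Activated M y (b :: u) := fun h => h a hya
          rw [GammaAux.eq_2 M y, dif_neg hy, if_neg hne, if_pos hp]
          exact Bool.le_true _
        · have hnone : ∀ b : Fin N, ¬ Activated M y (b :: u) := by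
            intro b hb
            refine hy ⟨b, hb, fun c hc => ?_⟩
            have hx' := fun d (hd : Activated M y (d :: u)) =>
              hxuniq d (hd.anti_of_even hxy (by simp only [List.length_cons]; omega))
            exact (hx' c hc).trans (hx' b hb).symm
          rw [GammaAux.eq_2 M y, dif_neg hy, if_pos hnone, if_neg (by omega)]
          exact Bool.le_true _
    · rw [GammaAux.eq_2 M x, dif_neg hx]
      rcases Nat.mod_two_eq_zero_or_one u.length with hp | hp
      · have mono := fun a (ha : Activated M x (a :: u)) =>
          ha.mono_of_odd hxy (by simp only [List.length_cons]; omega)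
        by_cases hnone : ∀ a : Fin N, ¬ Activated M x (a :: u)
        · rw [if_pos hnone, if_pos hp]
          exact Bool.false_le _
        · have hy : ¬ ∃! a : Fin N, Activated M y (a :: u) := by
            rintro ⟨b, -, hb⟩
            push Not at hnone
            obtain ⟨a, ha⟩ := hnone
            exact hx ⟨a, ha, fun c hc => (hb c (mono c hc)).trans (hb a (mono a ha)).symm⟩
          have hne : ¬ ∀ b : Fin N, ¬ Activated M y (b :: u) :=
            fun h => hnone fun a ha => h a (mono a ha)
          rw [GammaAux.eq_2 M y, dif_neg hy, if_neg hne, if_neg hnone, if_pos hp]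
          exact Bool.le_true _
      · have hp' : ¬ u.length % 2 = 0 := by omega
        by_cases hnone : ∀ a : Fin N, ¬ Activated M x (a :: u)
        · have hnone' : ∀ a : Fin N, ¬ Activated M y (a :: u) := fun a ha =>
            hnone a (ha.anti_of_even hxy (by simp only [List.length_cons]; omega))
          have hy : ¬ ∃! a : Fin N, Activated M y (a :: u) := fun ⟨a, ha, _⟩ => hnone' a ha
          rw [GammaAux.eq_2 M y, dif_neg hy, if_pos hnone', if_neg hp']
          exact Bool.le_true _
        · rw [if_neg hnone, if_neg hp']
          exact Bool.false_le _

lemma TalagrandFn_eq {n s N : ℕ} (ℓ : ℕ) (M : List (Fin N) → Fin s → Fin n)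
    (H : List (Fin N) → (Fin n → Bool) → Bool) (x : Fin n → Bool) :
    TalagrandFn ℓ M H x =
      if n + 2 * s < 2 * hwt x then true
      else if 2 * hwt x + 2 * s < n then false
      else (Gamma ℓ M x).eval H x := by
  unfold TalagrandFn
  cases Gamma ℓ M x <;> rfl

/-- if every leaf function `h_u` is constant, then `f_{M,H}` is monotone. -/
theorem stmt3 (ℓ n s : ℕ) (hℓ : 1 ≤ ℓ) (hn : 1 ≤ n) (hs : s * s = n)
    (M : List (Fin (2 ^ s)) → Fin s → Fin n)
    (H : List (Fin (2 ^ s)) → (Fin n → Bool) → Bool)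
    (hH : ∀ u : List (Fin (2 ^ s)), u.length = 2 * ℓ →
      ((∀ x, H u x = false) ∨ (∀ x, H u x = true))) :
    Monotone (TalagrandFn ℓ M H) := by
  intro x y hxy
  have hw := hwt_mono hxy
  have hmid : (Gamma ℓ M x).eval H x ≤ (Gamma ℓ M y).eval H y := by
    refine eval_GammaAux_le M H hxy (L := 2 * ℓ) (fun u hu => ?_) (2 * ℓ) [] (by simp)
    rcases hH u hu with h | h <;> rw [h x, h y]
  rw [TalagrandFn_eq, TalagrandFn_eq]
  split_ifs <;> first | omega | exact hmid | exact Bool.le_true _ | exact Bool.false_le _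
end

section
/- Let n ≥ 2 be an integer with √n an integer, and let P ⊆ P' be two nonempty finite sets of points of {0,1}^n lying in the middle layers. Assume |A_{P',0}| ≥ n/2 − 100√n(log₂ n)|P'| and |A_{P,1}| ≥ n/2 − 100√n(log₂ n)|P|. Then |A_{P,0}| ≥ n/2 − 150√n(log₂ n) · min(|P|², |P'|). -/
open Finset

/-- `x` lies in the middle layers: `n/2 - √n ≤ |x| ≤ n/2 + √n` (with `s = √n`). -/
def MiddleLayers (n s : ℕ) (x : Fin n → Bool) : Prop :=
  n ≤ 2 * hwt x + 2 * s ∧ 2 * hwt x ≤ n + 2 * s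

/-- `A_{S,b}`: the coordinates on which all points of `S` are equal to `b`. -/
def Aset {n : ℕ} (S : Finset (Fin n → Bool)) (b : Bool) : Finset (Fin n) :=
  univ.filter fun i => ∀ x ∈ S, x i = b

theorem Aset_anti {n : ℕ} {P P' : Finset (Fin n → Bool)} (h : P ⊆ P') (b : Bool) :
    Aset P' b ⊆ Aset P b := by
  intro i hi
  simp only [Aset, mem_filter, mem_univ, true_and] at hi ⊢
  exact fun x hx => hi x (h hx)

theorem Aset_true_card_le_hwt {n : ℕ} {P : Finset (Fin n → Bool)} {x : Fin n → Bool}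
    (hx : x ∈ P) : (Aset P true).card ≤ hwt x := by
  refine card_le_card fun i hi => ?_
  simp only [Aset, mem_filter, mem_univ, true_and] at hi ⊢
  exact hi x hx

/-- Every coordinate outside `Aset P false` lies in `Aset P true` or is a one of some `x ∈ P`
outside `Aset P true`. -/
theorem le_Aset_card_add_sum {n : ℕ} (P : Finset (Fin n → Bool)) :
    n ≤ (Aset P false).card + (Aset P true).card
      + ∑ x ∈ P, (hwt x - (Aset P true).card) := by
  classical
  have hcover : (univ : Finset (Fin n)) ⊆ (Aset P false ∪ Aset P true) ∪
      P.biUnion fun x => (univ.filter fun i => x i = true) \ Aset P true := by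
    intro i _
    by_cases h1 : i ∈ Aset P true
    · simp [h1]
    by_cases h0 : i ∈ Aset P false
    · simp [h0]
    refine mem_union_right _ (mem_biUnion.2 ?_)
    have h : ∃ x ∈ P, x i = true := by simpa [Aset] using h0
    obtain ⟨x, hx, hxi⟩ := h
    exact ⟨x, hx, by simp [hxi, h1]⟩
  have hsum : (P.biUnion fun x => (univ.filter fun i => x i = true) \ Aset P true).card
      ≤ ∑ x ∈ P, (hwt x - (Aset P true).card) := by
    refine card_biUnion_le.trans (sum_le_sum fun x hx => ?_)
    have hsubset : Aset P true ⊆ univ.filter fun i => x i = true := by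
      intro i hi
      simp only [Aset, mem_filter, mem_univ, true_and] at hi ⊢
      exact hi x hx
    rw [card_sdiff_of_subset hsubset, hwt]
  calc n = (univ : Finset (Fin n)).card := by simp
    _ ≤ _ := card_le_card hcover
    _ ≤ _ := card_union_le _ _
    _ ≤ _ := add_le_add (card_union_le _ _) hsum

theorem stmt6 (n s : ℕ) (hn : 2 ≤ n) (hs : s * s = n)
    (P P' : Finset (Fin n → Bool)) (hPne : P.Nonempty) (hP'ne : P'.Nonempty)
    (hsub : P ⊆ P') (hmid : ∀ x ∈ P', MiddleLayers n s x)
    (h0 : (n : ℝ) / 2 - 100 * s * Real.logb 2 n * P'.card ≤ ((Aset P' false).card : ℝ))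
    (h1 : (n : ℝ) / 2 - 100 * s * Real.logb 2 n * P.card ≤ ((Aset P true).card : ℝ)) :
    (n : ℝ) / 2 - 150 * s * Real.logb 2 n * min ((P.card : ℝ) ^ 2) (P'.card : ℝ)
      ≤ ((Aset P false).card : ℝ) := by
  have hlog : 1 ≤ Real.logb 2 n := by
    rw [Real.le_logb_iff_rpow_le (by norm_num) (by positivity), Real.rpow_one]
    exact_mod_cast hn
  have hp : (1 : ℝ) ≤ P.card := by exact_mod_cast hPne.card_pos
  have hs0 : (0 : ℝ) ≤ s := s.cast_nonneg
  have hL : (s : ℝ) ≤ s * Real.logb 2 n := le_mul_of_one_le_right hs0 hlog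
  rcases min_choice ((P.card : ℝ) ^ 2) (P'.card : ℝ) with hmin | hmin <;> rw [hmin]
  · have hwt_le : ∀ x ∈ P, (hwt x : ℝ) ≤ n / 2 + s := by
      intro x hx
      have h : (2 * hwt x : ℝ) ≤ n + 2 * s := by exact_mod_cast (hmid x (hsub hx)).2
      linarith
    obtain ⟨x₀, hx₀⟩ := hPne
    have hA1 : ((Aset P true).card : ℝ) ≤ n / 2 + s :=
      (Nat.cast_le.2 (Aset_true_card_le_hwt hx₀)).trans (hwt_le x₀ hx₀)
    have hcount : (n : ℝ) ≤ (Aset P false).card + (Aset P true).card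
        + ∑ x ∈ P, ((hwt x - (Aset P true).card : ℕ) : ℝ) := by
      exact_mod_cast le_Aset_card_add_sum P
    have hsum : ∑ x ∈ P, ((hwt x - (Aset P true).card : ℕ) : ℝ)
        ≤ P.card * (s + 100 * s * Real.logb 2 n * P.card) := by
      rw [← nsmul_eq_mul]
      refine sum_le_card_nsmul _ _ _ fun x hx => ?_
      rw [Nat.cast_sub (Aset_true_card_le_hwt hx)]
      linarith [hwt_le x hx]
    have hp2 : (P.card : ℝ) + 1 ≤ 50 * (P.card : ℝ) ^ 2 := by nlinarith
    have herr : (s : ℝ) * (P.card + 1) ≤ s * Real.logb 2 n * (50 * (P.card : ℝ) ^ 2) :=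
      mul_le_mul hL hp2 (by positivity) (hs0.trans hL)
    linarith
  · have hA : ((Aset P' false).card : ℝ) ≤ (Aset P false).card :=
      Nat.cast_le.2 (card_le_card (Aset_anti hsub false))
    have hnonneg : 0 ≤ s * Real.logb 2 n * P'.card :=
      mul_nonneg (hs0.trans hL) (Nat.cast_nonneg _)
    linarith
end
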